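/- Let I = (S,A,α,c,c_h,P̲,P̄,h) be an IMDP. Then there exists a deterministic policy π_δ (i.e., a policy such that for every k ∈ {0,…,h-1} and s ∈ S, π_δ(k,s) is an indicator vector in P^{|A|} ∩ {0,1}^{|A|}) that attains the robust minimum: max_{ξ∈Ξ} (J^{π_δ,ξ} + H(I^{π_δ,ξ})) = min_{π∈Π} max_{ξ∈Ξ} (J^{π,ξ} + H(I^{π,ξ})). -/

import Mathlib

open Finset

/-- The probability simplex over a finite type `T`. -/
def Simplex (T : Type) [Fintype T] : Set (T → ℝ) :=
  {p | (∀ t, 0 ≤ p t ∧ p t ≤ 1) ∧ ∑ t, p t = 1}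

/-- `Φ(p,V) = -∑_q p_q log₂ p_q + ∑_q p_q V_q` (with `0·log₂ 0 = 0`,
which holds automatically since `Real.logb 2 0 = 0`). -/
noncomputable def Phi {S : Type} [Fintype S] (p V : S → ℝ) : ℝ :=
  (-∑ q, p q * Real.logb 2 (p q)) + ∑ q, p q * V q

/-- The set `P_s^a` of feasible transition distributions for state `s` and action
`a`, given interval bounds `P̲ = Plo` and `P̄ = Pup`. -/
def Feas {S A : Type} [Fintype S] (Plo Pup : S → A → S → ℝ) (s : S) (a : A) :
    Set (S → ℝ) :=
  {p | p ∈ Simplex S ∧ ∀ q, Plo s a q ≤ p q ∧ p q ≤ Pup s a q}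

/-- `π` is a (Markov) policy for horizon `h`: `π k s ∈ P^{|A|}` for every `k < h`. -/
def IsPolicy {S A : Type} [Fintype A] (h : ℕ) (π : ℕ → S → A → ℝ) : Prop :=
  ∀ k, k < h → ∀ s, π k s ∈ Simplex A

/-- `ξ` is a (Markov) adversary for horizon `h`: `ξ k s a ∈ P_s^a` for every `k < h`. -/
def IsAdversary {S A : Type} [Fintype S] (h : ℕ) (Plo Pup : S → A → S → ℝ)
    (ξ : ℕ → S → A → S → ℝ) : Prop :=
  ∀ k, k < h → ∀ s a, ξ k s a ∈ Feas Plo Pup s a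

/-- The path probability mass function on `S^{h+1}` induced by policy `π` and
adversary `ξ`: `p(s₀,…,s_h) = α(s₀) · ∏_{k=0}^{h-1} p_k^{s_k}(s_{k+1})` where
`p_k^s = ∑_a π_k^a(s)·ξ_k^a(s)`. -/
noncomputable def pathProb {S A : Type} [Fintype S] [Fintype A] (h : ℕ) (α : S → ℝ)
    (π : ℕ → S → A → ℝ) (ξ : ℕ → S → A → S → ℝ) (path : Fin (h + 1) → S) : ℝ :=
  α (path 0) *
    ∏ k : Fin h, ∑ a, π k.1 (path k.castSucc) a * ξ k.1 (path k.castSucc) a (path k.succ)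

/-- The expected cumulative cost `J^{π,ξ}`. -/
noncomputable def cumCost {S A : Type} [Fintype S] [Fintype A] (h : ℕ) (α : S → ℝ)
    (c : S → A → ℝ) (ch : S → ℝ)
    (π : ℕ → S → A → ℝ) (ξ : ℕ → S → A → S → ℝ) : ℝ :=
  ∑ path : Fin (h + 1) → S,
    pathProb h α π ξ path *
      ((∑ k : Fin h, ∑ a, π k.1 (path k.castSucc) a * c (path k.castSucc) a) +
        ch (path (Fin.last h)))

/-- The path entropy `H(I^{π,ξ})` (with `0·log₂ 0 = 0`). -/
noncomputable def pathEnt {S A : Type} [Fintype S] [Fintype A] (h : ℕ) (α : S → ℝ)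
    (π : ℕ → S → A → ℝ) (ξ : ℕ → S → A → S → ℝ) : ℝ :=
  -∑ path : Fin (h + 1) → S,
    pathProb h α π ξ path * Real.logb 2 (pathProb h α π ξ path)

theorem mixture_mem_simplex {S A : Type} [Fintype S] [Fintype A] {w : A → ℝ} {p : A → S → ℝ}
    (hw : w ∈ Simplex A) (hp : ∀ a, p a ∈ Simplex S) :
    (fun q => ∑ a, w a * p a q) ∈ Simplex S := by
  have hsum : ∑ q, ∑ a, w a * p a q = 1 := by
    rw [sum_comm]
    simp_rw [← mul_sum, (hp _).2, mul_one]
    exact hw.2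
  have hnonneg : ∀ q, 0 ≤ ∑ a, w a * p a q := fun q =>
    sum_nonneg fun a _ => mul_nonneg (hw.1 a).1 ((hp a).1 q).1
  refine ⟨fun q => ⟨hnonneg q, ?_⟩, hsum⟩
  rw [← hsum]
  exact single_le_sum (f := fun q => ∑ a, w a * p a q) (fun i _ => hnonneg i) (mem_univ q)

theorem isCompact_feas {S A : Type} [Fintype S] (Plo Pup : S → A → S → ℝ) (s : S) (a : A) :
    IsCompact (Feas Plo Pup s a) := by
  have heq : Feas Plo Pup s a =
      Set.Icc (0 : S → ℝ) 1 ∩ ({p | ∑ q, p q = 1} ∩ Set.Icc (Plo s a) (Pup s a)) := by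
    ext p
    simp only [Feas, Simplex, Set.mem_ofPred_eq, Set.mem_inter_iff, Set.mem_Icc, Pi.le_def,
      Pi.zero_apply, Pi.one_apply, forall_and]
    tauto
  rw [heq]
  refine isCompact_Icc.inter_right (IsClosed.inter ?_ isClosed_Icc)
  exact isClosed_eq (by fun_prop) continuous_const

theorem Phi_eq_sum_negMulLog {S : Type} [Fintype S] (p V : S → ℝ) :
    Phi p V = ∑ q, (Real.negMulLog (p q) / Real.log 2 + p q * V q) := by
  rw [Phi, sum_add_distrib, ← sum_neg_distrib]
  congr 1
  refine sum_congr rfl fun q _ => ?_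
  rw [Real.negMulLog, Real.logb]
  ring

theorem continuous_Phi {S : Type} [Fintype S] (V : S → ℝ) : Continuous fun p => Phi p V := by
  simp_rw [Phi_eq_sum_negMulLog]
  refine continuous_finsetSum _ fun q _ => ?_
  exact ((Real.continuous_negMulLog.comp (continuous_apply q)).div_const _).add
    ((continuous_apply q).mul continuous_const)

theorem sum_mul_Phi_le_Phi_mixture {S A : Type} [Fintype S] [Fintype A] {w : A → ℝ}
    {p : A → S → ℝ} (hw : w ∈ Simplex A) (hp : ∀ a, p a ∈ Simplex S) (V : S → ℝ) :
    ∑ a, w a * Phi (p a) V ≤ Phi (fun q => ∑ a, w a * p a q) V := by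
  simp_rw [Phi_eq_sum_negMulLog, mul_sum]
  rw [sum_comm]
  refine sum_le_sum fun q _ => ?_
  have hconc := Real.concaveOn_negMulLog.le_map_sum (t := univ) (w := w) (p := fun a => p a q)
    (fun a _ => (hw.1 a).1) hw.2 (fun a _ => ((hp a).1 q).1)
  simp only [smul_eq_mul] at hconc
  have hlog : 0 < Real.log 2 := Real.log_pos one_lt_two
  calc ∑ a, w a * (Real.negMulLog (p a q) / Real.log 2 + p a q * V q)
      = (∑ a, w a * Real.negMulLog (p a q)) / Real.log 2 + (∑ a, w a * p a q) * V q := by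
        rw [sum_div, sum_mul, ← sum_add_distrib]
        exact sum_congr rfl fun a _ => by ring
    _ ≤ _ := by gcongr

section Objective

variable {S A : Type} [Fintype S] [Fintype A]

theorem pathProb_mem_Icc {h : ℕ} {α : S → ℝ} {π : ℕ → S → A → ℝ} {ξ : ℕ → S → A → S → ℝ}
    (hα : α ∈ Simplex S) (hπ : IsPolicy h π) (hξ : ∀ k < h, ∀ s a, ξ k s a ∈ Simplex S)
    (path : Fin (h + 1) → S) : pathProb h α π ξ path ∈ Set.Icc (0 : ℝ) 1 := by
  have hstep : ∀ k : Fin h,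
      0 ≤ ∑ a, π k.1 (path k.castSucc) a * ξ k.1 (path k.castSucc) a (path k.succ) ∧
        ∑ a, π k.1 (path k.castSucc) a * ξ k.1 (path k.castSucc) a (path k.succ) ≤ 1 := fun k =>
    (mixture_mem_simplex (hπ k k.2 (path k.castSucc)) (hξ k k.2 (path k.castSucc))).1 (path k.succ)
  have hprod := prod_nonneg fun k (_ : k ∈ univ) => (hstep k).1
  exact ⟨mul_nonneg (hα.1 _).1 hprod, mul_le_one₀ (hα.1 _).2 hprod
    (prod_le_one (fun k _ => (hstep k).1) fun k _ => (hstep k).2)⟩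

theorem mul_logb_mul (b x y : ℝ) :
    x * y * Real.logb b (x * y) = x * y * (Real.logb b x + Real.logb b y) := by
  rcases eq_or_ne x 0 with rfl | hx
  · simp
  rcases eq_or_ne y 0 with rfl | hy
  · simp
  rw [Real.logb_mul hx hy]

theorem pathProb_snoc (h : ℕ) (α : S → ℝ) (π : ℕ → S → A → ℝ) (ξ : ℕ → S → A → S → ℝ)
    (path : Fin (h + 1) → S) (q : S) :
    pathProb (h + 1) α π ξ (Fin.snoc path q : Fin (h + 2) → S) =
      pathProb h α π ξ path *
        ∑ a, π h (path (Fin.last h)) a * ξ h (path (Fin.last h)) a q := by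
  have hzero : (Fin.snoc path q : Fin (h + 2) → S) 0 = path 0 :=
    Fin.snoc_castSucc (α := fun _ => S) q path 0
  simp only [pathProb, Fin.prod_univ_castSucc, hzero, Fin.succ_castSucc, Fin.succ_last,
    Fin.snoc_castSucc, Fin.snoc_last, Fin.val_castSucc, Fin.val_last, mul_assoc]

/-- Cumulative cost plus path entropy. -/
noncomputable def objective (h : ℕ) (α : S → ℝ) (c : S → A → ℝ) (ch : S → ℝ)
    (π : ℕ → S → A → ℝ) (ξ : ℕ → S → A → S → ℝ) : ℝ :=
  cumCost h α c ch π ξ + pathEnt h α π ξ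

theorem objective_eq_sum (h : ℕ) (α : S → ℝ) (c : S → A → ℝ) (ch : S → ℝ)
    (π : ℕ → S → A → ℝ) (ξ : ℕ → S → A → S → ℝ) :
    objective h α c ch π ξ = ∑ path : Fin (h + 1) → S,
      (pathProb h α π ξ path *
          ((∑ k : Fin h, ∑ a, π k.1 (path k.castSucc) a * c (path k.castSucc) a) +
            ch (path (Fin.last h))) -
        pathProb h α π ξ path * Real.logb 2 (pathProb h α π ξ path)) := by
  rw [objective, cumCost, pathEnt, sum_sub_distrib, sub_eq_add_neg]

/-- One step of dynamic programming: the last stage is absorbed into the terminal cost. -/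
theorem objective_succ {h : ℕ} (α : S → ℝ) (c : S → A → ℝ) (ch : S → ℝ)
    {π : ℕ → S → A → ℝ} {ξ : ℕ → S → A → S → ℝ}
    (hmix : ∀ s, ∑ q, ∑ a, π h s a * ξ h s a q = 1) :
    objective (h + 1) α c ch π ξ = objective h α c (fun s => ∑ a, π h s a * c s a +
      Phi (fun q => ∑ a, π h s a * ξ h s a q) ch) π ξ := by
  rw [objective_eq_sum, objective_eq_sum,
    ← (Fin.snocEquiv fun _ : Fin (h + 2) => S).sum_comp, Fintype.sum_prod_type_right]
  refine sum_congr rfl fun path _ => ?_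
  have hsnoc : ∀ q, Fin.snocEquiv (fun _ : Fin (h + 2) => S) (q, path) =
      (Fin.snoc path q : Fin (h + 2) → S) := fun _ => rfl
  simp only [hsnoc, pathProb_snoc, mul_logb_mul, Fin.sum_univ_castSucc,
    Fin.snoc_castSucc, Fin.snoc_last, Fin.val_castSucc, Fin.val_last]
  have hm := hmix (path (Fin.last h))
  rw [Phi]
  set P := pathProb h α π ξ path
  set X := ∑ k : Fin h, ∑ a, π k.1 (path k.castSucc) a * c (path k.castSucc) a
  set R := ∑ a, π h (path (Fin.last h)) a * c (path (Fin.last h)) a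
  set m : S → ℝ := fun q => ∑ a, π h (path (Fin.last h)) a * ξ h (path (Fin.last h)) a q
  change ∑ q, m q = 1 at hm
  calc ∑ q, (P * m q * (X + R + ch q) - P * m q * (Real.logb 2 P + Real.logb 2 (m q)))
      = ∑ q, (P * (X + R - Real.logb 2 P) * m q + P * (m q * ch q) -
          P * (m q * Real.logb 2 (m q))) := sum_congr rfl fun q _ => by ring
    _ = P * (X + R - Real.logb 2 P) * ∑ q, m q + P * ∑ q, m q * ch q -
          P * ∑ q, m q * Real.logb 2 (m q) := by
        rw [sum_sub_distrib, sum_add_distrib, mul_sum, mul_sum, mul_sum]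
    _ = _ := by rw [hm]; ring

theorem objective_mono_terminal {h : ℕ} {α : S → ℝ} {c : S → A → ℝ} {g g' : S → ℝ}
    {π : ℕ → S → A → ℝ} {ξ : ℕ → S → A → S → ℝ} (hα : α ∈ Simplex S) (hπ : IsPolicy h π)
    (hξ : ∀ k < h, ∀ s a, ξ k s a ∈ Simplex S) (hg : ∀ s, g s ≤ g' s) :
    objective h α c g π ξ ≤ objective h α c g' π ξ := by
  rw [objective_eq_sum, objective_eq_sum]
  refine sum_le_sum fun path _ => sub_le_sub_right
    (mul_le_mul_of_nonneg_left (add_le_add_right (hg _) _)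
      (pathProb_mem_Icc hα hπ hξ path).1) _

theorem objective_congr {h : ℕ} (α : S → ℝ) (c : S → A → ℝ) (ch : S → ℝ)
    {π π' : ℕ → S → A → ℝ} {ξ ξ' : ℕ → S → A → S → ℝ}
    (hπ : ∀ k < h, π k = π' k) (hξ : ∀ k < h, ξ k = ξ' k) :
    objective h α c ch π ξ = objective h α c ch π' ξ' := by
  have hπ' : ∀ k : Fin h, π k = π' k := fun k => hπ k k.2
  have hξ' : ∀ k : Fin h, ξ k = ξ' k := fun k => hξ k k.2
  simp only [objective, cumCost, pathEnt, pathProb, hπ', hξ']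

theorem objective_bddAbove {h : ℕ} {α : S → ℝ} (c : S → A → ℝ) (ch : S → ℝ)
    (Plo Pup : S → A → S → ℝ) {π : ℕ → S → A → ℝ} (hα : α ∈ Simplex S) (hπ : IsPolicy h π) :
    BddAbove {y | ∃ ξ, IsAdversary h Plo Pup ξ ∧ y = objective h α c ch π ξ} := by
  refine ⟨∑ path : Fin (h + 1) → S,
    (|(∑ k : Fin h, ∑ a, π k.1 (path k.castSucc) a * c (path k.castSucc) a) +
      ch (path (Fin.last h))| + 1 / Real.log 2), ?_⟩
  rintro y ⟨ξ, hξ, rfl⟩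
  rw [objective_eq_sum]
  refine sum_le_sum fun path _ => ?_
  obtain ⟨h0, h1⟩ := pathProb_mem_Icc hα hπ (fun k hk s a => (hξ k hk s a).1) path
  set P := pathProb h α π ξ path
  rw [sub_eq_add_neg]
  refine add_le_add ((mul_le_mul_of_nonneg_left (le_abs_self _) h0).trans
    (mul_le_of_le_one_left (abs_nonneg _) h1)) ?_
  have hent : -(P * Real.log P) ≤ 1 := by
    rcases h0.eq_or_lt with hP | hP
    · simp [← hP]
    have hle := mul_le_mul_of_nonneg_left (Real.one_sub_inv_le_log_of_pos hP) hP.le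
    rw [mul_sub, mul_inv_cancel₀ hP.ne'] at hle
    linarith
  have hlog : 0 < Real.log 2 := Real.log_pos one_lt_two
  rw [Real.logb, ← mul_div_assoc, ← neg_div]
  gcongr

/-- A deterministic policy and an adversary forming a saddle point of the objective. -/
theorem exists_deterministic_saddle [Nonempty A] {α : S → ℝ} (hα : α ∈ Simplex S)
    (c : S → A → ℝ) (Plo Pup : S → A → S → ℝ) (hfeas : ∀ s a, (Feas Plo Pup s a).Nonempty)
    (h : ℕ) (ch : S → ℝ) :
    ∃ (πδ : ℕ → S → A → ℝ) (ξs : ℕ → S → A → S → ℝ) (L : ℝ),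
      IsPolicy h πδ ∧ (∀ k < h, ∀ s a, πδ k s a = 0 ∨ πδ k s a = 1) ∧
      IsAdversary h Plo Pup ξs ∧
      (∀ ξ, IsAdversary h Plo Pup ξ → objective h α c ch πδ ξ ≤ L) ∧
      ∀ π, IsPolicy h π → L ≤ objective h α c ch π ξs := by
  classical
  induction h generalizing ch with
  | zero =>
    refine ⟨0, 0, objective 0 α c ch 0 0, by simp [IsPolicy], by simp, by simp [IsAdversary],
      fun ξ _ => (objective_congr _ _ _ (by simp) (by simp)).le,
      fun π _ => (objective_congr _ _ _ (by simp) (by simp)).le⟩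
  | succ h ih =>
    choose p hpF hpmax using fun s a => (isCompact_feas Plo Pup s a).exists_isMaxOn (hfeas s a)
      (continuous_Phi ch).continuousOn
    choose act hact using fun s => Finite.exists_min fun a => c s a + Phi (p s a) ch
    obtain ⟨πδ, ξs, L, hπ, hdet, hξs, hub, hlb⟩ := ih fun s => c s (act s) + Phi (p s (act s)) ch
    set π' := Function.update πδ h fun s => Pi.single (act s) 1
    set ξ' := Function.update ξs h p
    have hπ'_lt : ∀ k < h, π' k = πδ k := fun k hk => Function.update_of_ne hk.ne _ _
    have hξ'_lt : ∀ k < h, ξ' k = ξs k := fun k hk => Function.update_of_ne hk.ne _ _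
    have hπ'_eq : π' h = fun s => Pi.single (act s) 1 := Function.update_self _ _ _
    have hξ'_eq : ξ' h = p := Function.update_self _ _ _
    have hπ'_det : ∀ k < h + 1, ∀ s a, π' k s a = 0 ∨ π' k s a = 1 := by
      intro k hk s a
      rcases (Nat.lt_succ_iff.mp hk).lt_or_eq with hk | rfl
      · rw [hπ'_lt k hk]; exact hdet k hk s a
      · simp only [hπ'_eq, Pi.single_apply]; split_ifs <;> simp
    have hπ' : IsPolicy (h + 1) π' := by
      intro k hk s
      rcases (Nat.lt_succ_iff.mp hk).lt_or_eq with hk | rfl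
      · rw [hπ'_lt k hk]; exact hπ k hk s
      · refine ⟨fun a => ?_, by simp [hπ'_eq]⟩
        rcases hπ'_det k hk s a with h0 | h0 <;> simp [h0]
    have hξ' : IsAdversary (h + 1) Plo Pup ξ' := by
      intro k hk s a
      rcases (Nat.lt_succ_iff.mp hk).lt_or_eq with hk | rfl
      · rw [hξ'_lt k hk]; exact hξs k hk s a
      · rw [hξ'_eq]; exact hpF s a
    refine ⟨π', ξ', L, hπ', hπ'_det, hξ', fun ξ hξ => ?_, fun π hπ0 => ?_⟩
    · rw [objective_succ α c ch fun s => (mixture_mem_simplex (hπ' h h.lt_succ_self s)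
        fun a => (hξ h h.lt_succ_self s a).1).2]
      refine (objective_mono_terminal hα (fun k hk => hπ' k (hk.trans h.lt_succ_self))
        (fun k hk s a => (hξ k (hk.trans h.lt_succ_self) s a).1) fun s => ?_).trans
        ((objective_congr α c _ hπ'_lt fun _ _ => rfl).le.trans
          (hub ξ fun k hk => hξ k (hk.trans h.lt_succ_self)))
      simp only [hπ'_eq, Pi.single_apply, ite_mul, one_mul, zero_mul, sum_ite_eq', mem_univ,
        if_true]
      exact add_le_add_right (hpmax s (act s) (hξ h h.lt_succ_self s (act s))) _
    · rw [objective_succ α c ch fun s => (mixture_mem_simplex (hπ0 h h.lt_succ_self s)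
        fun a => (hξ' h h.lt_succ_self s a).1).2]
      refine (hlb π fun k hk => hπ0 k (hk.trans h.lt_succ_self)).trans
        ((objective_congr α c _ (fun _ _ => rfl) fun k hk => (hξ'_lt k hk).symm).le.trans
          (objective_mono_terminal hα (fun k hk => hπ0 k (hk.trans h.lt_succ_self))
            (fun k hk s a => (hξ' k (hk.trans h.lt_succ_self) s a).1) fun s => ?_))
      have hw := hπ0 h h.lt_succ_self s
      rw [hξ'_eq]
      calc c s (act s) + Phi (p s (act s)) ch
          = ∑ a, π h s a * (c s (act s) + Phi (p s (act s)) ch) := by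
            rw [← sum_mul, hw.2, one_mul]
        _ ≤ ∑ a, π h s a * (c s a + Phi (p s a) ch) :=
            sum_le_sum fun a _ => mul_le_mul_of_nonneg_left (hact s a) (hw.1 a).1
        _ = ∑ a, π h s a * c s a + ∑ a, π h s a * Phi (p s a) ch := by
            simp_rw [mul_add, sum_add_distrib]
        _ ≤ _ := add_le_add_right
            (sum_mul_Phi_le_Phi_mixture hw (fun a => (hpF s a).1) ch) _

end Objective

/-- Deterministic policies suffice: for an IMDP
`I = (S,A,α,c,c_h,P̲,P̄,h)`, there exists a deterministic policy `π_δ` (each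
`π_δ(k,s)` is an indicator vector in `P^{|A|} ∩ {0,1}^{|A|}`) attaining the robust
minimum:
`max_{ξ∈Ξ} (J^{π_δ,ξ} + H(I^{π_δ,ξ})) = min_{π∈Π} max_{ξ∈Ξ} (J^{π,ξ} + H(I^{π,ξ}))`. -/
theorem deterministic_policy_minimizes
    {S A : Type} [Fintype S] [Fintype A] [Nonempty S] [Nonempty A]
    (h : ℕ) (α : S → ℝ) (c : S → A → ℝ) (ch : S → ℝ)
    (Plo Pup : S → A → S → ℝ)
    (hα : α ∈ Simplex S)
    (hbounds : ∀ s a q, 0 ≤ Plo s a q ∧ Plo s a q ≤ Pup s a q ∧ Pup s a q ≤ 1)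
    (hsums : ∀ s a, ∑ q, Plo s a q ≤ 1 ∧ 1 ≤ ∑ q, Pup s a q)
    (hfeas : ∀ s a, (Feas Plo Pup s a).Nonempty) :
    ∃ πδ : ℕ → S → A → ℝ,
      IsPolicy h πδ ∧
      (∀ k, k < h → ∀ s a, πδ k s a = 0 ∨ πδ k s a = 1) ∧
      sSup {y | ∃ ξ, IsAdversary h Plo Pup ξ ∧
          y = cumCost h α c ch πδ ξ + pathEnt h α πδ ξ}
        = sInf {x | ∃ π, IsPolicy h π ∧ x =
            sSup {y | ∃ ξ, IsAdversary h Plo Pup ξ ∧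
              y = cumCost h α c ch π ξ + pathEnt h α π ξ}} := by
  obtain ⟨πδ, ξs, L, hπ, hdet, hξs, hub, hlb⟩ :=
    exists_deterministic_saddle hα c Plo Pup hfeas h ch
  have hgreatest : IsGreatest {y | ∃ ξ, IsAdversary h Plo Pup ξ ∧
      y = objective h α c ch πδ ξ} L := by
    refine ⟨⟨ξs, hξs, (hlb πδ hπ).antisymm (hub ξs hξs)⟩, ?_⟩
    rintro y ⟨ξ, hξ, rfl⟩
    exact hub ξ hξ
  have hleast : IsLeast {x | ∃ π, IsPolicy h π ∧ x =
      sSup {y | ∃ ξ, IsAdversary h Plo Pup ξ ∧ y = objective h α c ch π ξ}} L := by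
    refine ⟨⟨πδ, hπ, hgreatest.csSup_eq.symm⟩, ?_⟩
    rintro x ⟨π, hπ', rfl⟩
    exact (hlb π hπ').trans
      (le_csSup (objective_bddAbove c ch Plo Pup hα hπ') ⟨ξs, hξs, rfl⟩)
  exact ⟨πδ, hπ, hdet, hgreatest.csSup_eq.trans hleast.csInf_eq.symm⟩
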